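/- For every integer k ≥ 2 and every real s > 1, the Dirichlet series Σ_{n=1}^∞ f_{(σ,k)}(n)/n^s converges and equals ζ(s)^k·ζ(ks − 1). -/

import Mathlib

open Finset

/-- The set of ordered `k`-tuples of positive integers whose product is `n`. -/
def piltzTuples (k n : ℕ) : Finset (Fin k → ℕ) :=
  (Fintype.piFinset fun _ => n.divisors).filter fun d => ∏ i, d i = n

/-- `f_{(g,k)}(n) = ∑_{d₁⋯d_k = n} g(gcd(d₁,…,d_k))` (ℕ-valued version). -/
def fgkNat (g : ℕ → ℕ) (k n : ℕ) : ℕ :=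
  ∑ d ∈ piltzTuples k n, g (Finset.univ.gcd d)

lemma hasSum_pi_prod {f : ℕ → ℂ} {a : ℂ} (hf : HasSum f a) (hn : Summable fun n => ‖f n‖) (k : ℕ) :
    HasSum (fun c : Fin k → ℕ => ∏ i, f (c i)) (a ^ k) ∧
      Summable fun c : Fin k → ℕ => ‖∏ i, f (c i)‖ := by
  induction k with
  | zero =>
    refine ⟨?_, Summable.of_finite⟩
    convert hasSum_fintype fun c : Fin 0 → ℕ => ∏ i, f (c i)
    simp
  | succ k ih =>
    obtain ⟨h₁, h₂⟩ := ih
    have h₃ := summable_mul_of_summable_norm (f := f) (g := fun c : Fin k → ℕ => ∏ i, f (c i)) hn h₂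
    have h₄ := hf.mul h₁ h₃
    have h₅ := Summable.mul_norm (f := f) (g := fun c : Fin k → ℕ => ∏ i, f (c i)) hn h₂
    have hcons : (fun c : Fin (k + 1) → ℕ => ∏ i, f (c i)) ∘ (Fin.consEquiv fun _ => ℕ) =
        fun x : ℕ × (Fin k → ℕ) => f x.1 * ∏ i, f (x.2 i) := by
      ext x
      simp [Fin.consEquiv, Fin.prod_univ_succ]
    constructor
    · rw [pow_succ', ← (Fin.consEquiv fun _ : Fin (k + 1) => ℕ).hasSum_iff, hcons]
      exact h₄
    · rw [← (Fin.consEquiv fun _ : Fin (k + 1) => ℕ).summable_iff]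
      exact h₅.congr fun x => congrArg norm (congrFun hcons x).symm

/-- Pairs `(e, c)` with `e ^ k * ∏ i, c i = n`, where `e` and all `c i` divide `n` and `n ≠ 0`. -/
def scaledTuples (k n : ℕ) : Finset (ℕ × (Fin k → ℕ)) :=
  (n.divisors ×ˢ Fintype.piFinset fun _ => n.divisors).filter fun p => p.1 ^ k * ∏ i, p.2 i = n

lemma mem_piltzTuples {k n : ℕ} (hn : n ≠ 0) {d : Fin k → ℕ} :
    d ∈ piltzTuples k n ↔ ∏ i, d i = n := by
  simp only [piltzTuples, mem_filter, Fintype.mem_piFinset, Nat.mem_divisors]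
  refine ⟨And.right, fun h => ⟨fun i => ⟨?_, hn⟩, h⟩⟩
  exact h ▸ dvd_prod_of_mem d (mem_univ i)

lemma mem_scaledTuples {k n : ℕ} (hk : k ≠ 0) (hn : n ≠ 0) {p : ℕ × (Fin k → ℕ)} :
    p ∈ scaledTuples k n ↔ p.1 ^ k * ∏ i, p.2 i = n := by
  simp only [scaledTuples, mem_filter, mem_product, Fintype.mem_piFinset, Nat.mem_divisors]
  refine ⟨And.right, fun h => ⟨⟨⟨?_, hn⟩, fun i => ⟨?_, hn⟩⟩, h⟩⟩
  · exact h ▸ (dvd_pow_self _ hk).mul_right _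
  · exact h ▸ (dvd_prod_of_mem p.2 (mem_univ i)).mul_left _

lemma fgkNat_sum_divisors {k n : ℕ} (hk : k ≠ 0) (hn : n ≠ 0) (h : ℕ → ℕ) :
    fgkNat (fun m => ∑ e ∈ m.divisors, h e) k n = ∑ p ∈ scaledTuples k n, h p.1 := by
  have : Nonempty (Fin k) := ⟨⟨0, Nat.pos_of_ne_zero hk⟩⟩
  rw [fgkNat, Finset.sum_sigma']
  refine Finset.sum_bij' (fun x _ => (x.2, fun i => x.1 i / x.2))
    (fun p _ => ⟨fun i => p.1 * p.2 i, p.1⟩) ?_ ?_ ?_ ?_ ?_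
  · rintro ⟨d, e⟩ hx
    simp only [mem_sigma, mem_piltzTuples hn, Nat.mem_divisors, Finset.dvd_gcd_iff, mem_univ,
      true_implies] at hx
    rw [mem_scaledTuples hk hn, ← hx.1]
    calc e ^ k * ∏ i, d i / e = ∏ i, e * (d i / e) := by simp [prod_mul_distrib]
      _ = ∏ i, d i := prod_congr rfl fun i _ => Nat.mul_div_cancel' (hx.2.1 i)
  · rintro ⟨e, c⟩ hp
    rw [mem_scaledTuples hk hn] at hp
    have hprod : ∏ i, e * c i = n := by simpa [prod_mul_distrib] using hp
    simp only [mem_sigma, mem_piltzTuples hn, Nat.mem_divisors, Finset.dvd_gcd_iff, mem_univ,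
      true_implies]
    refine ⟨hprod, fun i => dvd_mul_right _ _, fun h0 => hn ?_⟩
    rw [← hprod]
    obtain ⟨i⟩ := this
    exact prod_eq_zero (mem_univ i) (Finset.gcd_eq_zero_iff.1 h0 i (mem_univ i))
  · rintro ⟨d, e⟩ hx
    simp only [mem_sigma, Nat.mem_divisors, Finset.dvd_gcd_iff, mem_univ, true_implies] at hx
    have : (fun i => e * (d i / e)) = d := funext fun i => Nat.mul_div_cancel' (hx.2.1 i)
    simp [this]
  · rintro ⟨e, c⟩ hp
    rw [mem_scaledTuples hk hn] at hp
    have he : 0 < e := Nat.pos_of_ne_zero <| by rintro rfl; simp [hk] at hp; exact hn hp.symm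
    simp [he]
  · intros; rfl

lemma hasSum_natCast_cpow_neg {s : ℂ} (hs : 1 < s.re) :
    HasSum (fun n : ℕ => (n : ℂ) ^ (-s)) (riemannZeta s) := by
  have h := (summable_riemannZetaSummand hs).of_norm.hasSum
  rwa [tsum_riemannZetaSummand hs] at h

theorem stmt10 (k : ℕ) (hk : 2 ≤ k) (s : ℝ) (hs : 1 < s) :
    HasSum (fun n : ℕ => (fgkNat (fun m => ∑ d ∈ m.divisors, d) k n : ℂ) / (n : ℂ) ^ (s : ℂ))
      (riemannZeta s ^ k * riemannZeta ((k : ℂ) * (s : ℂ) - 1)) := by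
  have hk0 : k ≠ 0 := by omega
  have hs0 : (s : ℂ) ≠ 0 := by exact_mod_cast (zero_lt_one.trans hs).ne'
  have hsre : 1 < (s : ℂ).re := by simpa
  have htre : 1 < ((k : ℂ) * (s : ℂ) - 1).re := by
    have : (2 : ℝ) ≤ k := by exact_mod_cast hk
    simp
    nlinarith
  have ht0 : (k : ℂ) * (s : ℂ) - 1 ≠ 0 := Complex.ne_zero_of_one_lt_re htre
  set φ := riemannZetaSummandHom hs0
  have φ_apply (n : ℕ) : φ n = (n : ℂ) ^ (-(s : ℂ)) := rfl
  obtain ⟨h₁, h₂⟩ := hasSum_pi_prod (hasSum_natCast_cpow_neg hsre)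
    (summable_riemannZetaSummand hsre) k
  have h₂' := summable_mul_of_summable_norm
    (f := fun n : ℕ => (n : ℂ) ^ (-((k : ℂ) * (s : ℂ) - 1)))
    (g := fun c : Fin k → ℕ => ∏ i, (c i : ℂ) ^ (-(s : ℂ))) (summable_riemannZetaSummand htre) h₂
  have h₃ := (hasSum_natCast_cpow_neg htre).mul h₁
    h₂'
  have hterm (e : ℕ) : (e : ℂ) ^ (-((k : ℂ) * (s : ℂ) - 1)) = e * φ e ^ k := by
    rcases eq_or_ne e 0 with rfl | he
    · rw [Nat.cast_zero, Complex.zero_cpow (neg_ne_zero.2 ht0), zero_mul]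
    · have he' : (e : ℂ) ≠ 0 := by exact_mod_cast he
      rw [φ_apply, ← Complex.cpow_nat_mul,
        show -((k : ℂ) * (s : ℂ) - 1) = 1 + k * (-s) by ring, Complex.cpow_add _ _ he',
        Complex.cpow_one]
  have h₄ : HasSum (fun p : ℕ × (Fin k → ℕ) => (p.1 : ℂ) * φ (p.1 ^ k * ∏ i, p.2 i))
      (riemannZeta s ^ k * riemannZeta ((k : ℂ) * (s : ℂ) - 1)) := by
    rw [mul_comm (riemannZeta s ^ k)]
    refine (congrArg (HasSum · _) (funext fun p => ?_)).mpr h₃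
    rw [hterm, map_mul, map_pow, map_prod, mul_assoc]
    rfl
  refine (congrArg (HasSum · _) (funext fun n => ?_)).mpr
    (h₄.tsum_fiberwise fun p => p.1 ^ k * ∏ i, p.2 i)
  have hfib : ∀ p : (fun p : ℕ × (Fin k → ℕ) => p.1 ^ k * ∏ i, p.2 i) ⁻¹' {n},
      ((p : ℕ × (Fin k → ℕ)).1 : ℂ) * φ (p.1.1 ^ k * ∏ i, p.1.2 i) = p.1.1 * φ n := by
    rintro ⟨p, hp⟩
    rw [Set.mem_preimage, Set.mem_singleton_iff] at hp
    simp only [hp]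
  rw [tsum_congr hfib]
  rcases eq_or_ne n 0 with rfl | hn
  · simp [Complex.zero_cpow hs0]
  · have hset : (fun p : ℕ × (Fin k → ℕ) => p.1 ^ k * ∏ i, p.2 i) ⁻¹' {n} =
        (scaledTuples k n : Set (ℕ × (Fin k → ℕ))) := by
      ext p
      simp [mem_scaledTuples hk0 hn]
    rw [hset, Finset.tsum_subtype' (scaledTuples k n) fun p => (p.1 : ℂ) * φ n, ← sum_mul,
      fgkNat_sum_divisors hk0 hn fun e => e, φ_apply, Complex.cpow_neg, div_eq_mul_inv]
    push_cast
    rfl
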